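/- arXiv:math/0502560 — 3 statements merged into one kernel-verified Lean document; each statement's English description precedes it below -/
import Mathlib

section
/- Let N : ℚ → ℝ be a function such that N(0) = 0, N(x) > 0 for all x ≠ 0, N(x·y) = N(x)·N(y) for all x, y ∈ ℚ, and there exists C ≥ 1 with N(x + y) ≤ C·(N(x) + N(y)) for all x, y ∈ ℚ. If N is Archimedean, i.e., N(x) > 1 for some integer x, then there exists a real number α > 0 such that N(x) = |x|^α for every x ∈ ℚ, where |x| denotes the usual absolute value. -/
theorem aux_pow2 (M : ℚ → ℝ) (h2 : ∀ x y B, M x ≤ B → M y ≤ B → M (x + y) ≤ 2 * B)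
    (k : ℕ) : ∀ (a : ℕ → ℚ) (B : ℝ), (∀ i, M (a i) ≤ B) →
      M (∑ i ∈ Finset.range (2 ^ k), a i) ≤ 2 ^ k * B := by
  induction k with
  | zero => intro a B h; simpa using h 0
  | succ k ih =>
    intro a B h
    have e : 2 ^ (k + 1) = 2 ^ k + 2 ^ k := by ring
    rw [e, Finset.sum_range_add]
    have := h2 _ _ _ (ih a B h) (ih (fun i => a (2 ^ k + i)) B (fun i => h _))
    calc _ ≤ _ := this
      _ = _ := by ring

theorem aux_exists_pow (n : ℕ) (hn : 1 ≤ n) : ∃ k : ℕ, n ≤ 2 ^ k ∧ 2 ^ k ≤ 2 * n := by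
  induction n, hn using Nat.le_induction with
  | base => exact ⟨0, by norm_num⟩
  | succ n hn ih =>
    obtain ⟨k, h1, h3⟩ := ih
    by_cases h : n + 1 ≤ 2 ^ k
    · exact ⟨k, h, by omega⟩
    · refine ⟨k + 1, ?_, ?_⟩ <;> rw [pow_succ] <;> omega

theorem aux_sum (M : ℚ → ℝ) (h0 : M 0 = 0)
    (h2 : ∀ x y B, M x ≤ B → M y ≤ B → M (x + y) ≤ 2 * B)
    (n : ℕ) (hn : 1 ≤ n) (a : ℕ → ℚ) (B : ℝ) (hB : 0 ≤ B) (h : ∀ i < n, M (a i) ≤ B) :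
    M (∑ i ∈ Finset.range n, a i) ≤ 2 * n * B := by
  obtain ⟨k, h1, h3⟩ := aux_exists_pow n hn
  have key := aux_pow2 M h2 k (fun i => if i < n then a i else 0) B (by
    intro i
    by_cases hi : i < n
    · simpa [hi] using h i hi
    · simpa [hi, h0] using hB)
  have e : ∑ i ∈ Finset.range n, a i
      = ∑ i ∈ Finset.range (2 ^ k), (if i < n then a i else 0) := by
    rw [← Finset.sum_subset (Finset.range_mono h1)]
    · exact Finset.sum_congr rfl (fun i hi => by simp [Finset.mem_range.1 hi])
    · intro i _ hi
      simpa using fun h' => absurd (Finset.mem_range.2 h') hi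
  rw [e]
  refine key.trans (mul_le_mul_of_nonneg_right ?_ hB)
  exact_mod_cast h3

theorem aux_tri (M : ℚ → ℝ) (h0 : M 0 = 0) (hpos : ∀ x, x ≠ 0 → 0 < M x)
    (hmul : ∀ x y, M (x * y) = M x * M y)
    (h2 : ∀ x y B, M x ≤ B → M y ≤ B → M (x + y) ≤ 2 * B) (x y : ℚ) :
    M (x + y) ≤ M x + M y := by
  have hnn : ∀ x, 0 ≤ M x := fun x => by
    by_cases h : x = 0
    · simp [h, h0]
    · exact (hpos x h).le
  have h1 : M 1 = 1 := by
    have := hmul 1 1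
    have h := hpos 1 one_ne_zero
    rw [mul_one] at this
    nlinarith
  have hpow : ∀ x n, M (x ^ n) = M x ^ n := fun x n => by
    induction n with
    | zero => simp [h1]
    | succ n ih => rw [pow_succ, hmul, ih, pow_succ]
  have hnat : ∀ n : ℕ, M n ≤ 2 * n := fun n => by
    rcases Nat.eq_zero_or_pos n with rfl | hn
    · simp [h0]
    · simpa using aux_sum M h0 h2 n hn (fun _ => 1) 1 zero_le_one (fun _ _ => h1.le)
  by_cases hx : x = 0
  · simp [hx, h0]
  have hs : 0 < M x + M y := add_pos_of_pos_of_nonneg (hpos x hx) (hnn y)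
  have hb : ∀ n : ℕ, M (x + y) ^ n ≤ 4 * (n + 1) * (M x + M y) ^ n := fun n => by
    rw [← hpow, add_pow]
    have := aux_sum M h0 h2 (n + 1) (by omega)
      (fun m => x ^ m * y ^ (n - m) * (n.choose m : ℚ)) (2 * (M x + M y) ^ n) (by positivity) (by
        intro i hi
        rw [hmul, hmul, hpow, hpow, add_pow]
        have hle := Finset.single_le_sum
          (f := fun m => M x ^ m * M y ^ (n - m) * (n.choose m : ℝ))
          (fun m _ => mul_nonneg (mul_nonneg (pow_nonneg (hnn x) _) (pow_nonneg (hnn y) _))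
            (Nat.cast_nonneg _)) (Finset.mem_range.2 hi)
        have h3 := mul_le_mul_of_nonneg_left (hnat (n.choose i))
          (mul_nonneg (pow_nonneg (hnn x) i) (pow_nonneg (hnn y) (n - i)))
        linarith)
    refine this.trans (le_of_eq ?_)
    push_cast
    ring
  by_contra! hlt
  have hr : 1 < M (x + y) / (M x + M y) := (one_lt_div hs).2 hlt
  have hb' : ∀ n : ℕ, (M (x + y) / (M x + M y)) ^ n ≤ 4 * (n + 1) := fun n => by
    rw [div_pow, div_le_iff₀ (pow_pos hs n)]
    exact hb n
  generalize M (x + y) / (M x + M y) = r at hr hb'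
  have t1 := tendsto_pow_const_div_const_pow_of_one_lt 1 hr
  have t0 := tendsto_pow_const_div_const_pow_of_one_lt 0 hr
  have t := (t1.add t0).const_mul 4
  simp only [add_zero, mul_zero] at t
  obtain ⟨n, hn⟩ := (t.eventually (gt_mem_nhds zero_lt_one)).exists
  have hrn : 0 < r ^ n := by positivity
  rw [← add_div, ← mul_div_assoc, div_lt_one hrn] at hn
  have := hb' n
  simp at hn
  linarith

theorem stmt_0 (N : ℚ → ℝ)
    (hN0 : N 0 = 0)
    (hNpos : ∀ x : ℚ, x ≠ 0 → N x > 0)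
    (hNmul : ∀ x y : ℚ, N (x * y) = N x * N y)
    (hNadd : ∃ C : ℝ, C ≥ 1 ∧ ∀ x y : ℚ, N (x + y) ≤ C * (N x + N y))
    (hArch : ∃ x : ℤ, N (x : ℚ) > 1) :
    ∃ α : ℝ, α > 0 ∧ ∀ x : ℚ, N x = |(x : ℝ)| ^ α := by
  obtain ⟨C, hC, hadd⟩ := hNadd
  obtain ⟨z, hz⟩ := hArch
  have hnn : ∀ x, 0 ≤ N x := fun x => by
    by_cases h : x = 0
    · simp [h, hN0]
    · exact (hNpos x h).le
  obtain ⟨c, hc, hc2⟩ : ∃ c : ℝ, 0 < c ∧ (2 * C) ^ c = 2 :=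
    ⟨Real.logb (2 * C) 2, Real.logb_pos (by linarith) (by norm_num),
      Real.rpow_logb (by linarith) (by linarith) (by norm_num)⟩
  have h2 : ∀ x y B, N x ^ c ≤ B → N y ^ c ≤ B → N (x + y) ^ c ≤ 2 * B := by
    intro x y B hx hy
    have hm : N (x + y) ≤ (2 * C) * max (N x) (N y) := by
      refine (hadd x y).trans ?_
      have := le_max_left (N x) (N y)
      have := le_max_right (N x) (N y)
      nlinarith
    refine (Real.rpow_le_rpow (hnn _) hm hc.le).trans ?_
    rw [Real.mul_rpow (by linarith) (le_max_of_le_left (hnn x)), hc2]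
    rcases max_choice (N x) (N y) with h | h <;> rw [h] <;> linarith
  have h0 : N 0 ^ c = 0 := by rw [hN0, Real.zero_rpow hc.ne']
  have hp : ∀ x, x ≠ 0 → 0 < N x ^ c := fun x hx => Real.rpow_pos_of_pos (hNpos x hx) c
  have hm : ∀ x y, N (x * y) ^ c = N x ^ c * N y ^ c := fun x y => by
    rw [hNmul, Real.mul_rpow (hnn x) (hnn y)]
  let f : AbsoluteValue ℚ ℝ :=
    { toFun := fun x => N x ^ c
      map_mul' := hm
      nonneg' := fun x => Real.rpow_nonneg (hnn x) c
      eq_zero' := fun x => ⟨fun h => by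
        by_contra hx
        exact (hp x hx).ne' h, fun h => by rw [h]; exact h0⟩
      add_le' := aux_tri (fun x => N x ^ c) h0 hp hm h2 }
  have hf : ∀ x, f x = N x ^ c := fun x => rfl
  have hub : ¬ ∀ n : ℕ, f n ≤ 1 := fun h => by
    have h1 : 1 < f (z : ℚ) := Real.one_lt_rpow hz hc
    have h3 := h z.natAbs
    rcases Int.natAbs_eq z with e | e
    · rw [e] at h1
      simp only [Int.cast_natCast] at h1
      linarith
    · rw [e] at h1
      simp only [Int.cast_neg, Int.cast_natCast, f.map_neg] at h1
      linarith
  have heq := Rat.AbsoluteValue.equiv_real_of_unbounded hub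
  obtain ⟨d, hd, hfd⟩ := AbsoluteValue.isEquiv_iff_exists_rpow_eq.1 heq
  refine ⟨(c * d)⁻¹, by positivity, fun x => ?_⟩
  have hx := congrFun hfd x
  simp only [hf, Rat.AbsoluteValue.real_eq_abs] at hx
  rw [← Real.rpow_mul (hnn x)] at hx
  have hx' : N x ^ (c * d) = |(x : ℝ)| := by rw [hx]; simp
  rw [← hx', Real.rpow_rpow_inv (hnn x) (by positivity)]
end

section
/- Let N : ℚ → ℝ be a function such that N(0) = 0, N(x) > 0 for all x ≠ 0, N(x·y) = N(x)·N(y) for all x, y ∈ ℚ, and there exists C ≥ 1 with N(x + y) ≤ C·(N(x) + N(y)) for all x, y ∈ ℚ. If N is non-Archimedean, i.e., N(x) ≤ 1 for every integer x, then N satisfies the ultrametric inequality: N(x + y) ≤ max(N(x), N(y)) for all x, y ∈ ℚ. -/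
theorem stmt_1 (N : ℚ → ℝ)
    (hN0 : N 0 = 0)
    (hNpos : ∀ x : ℚ, x ≠ 0 → N x > 0)
    (hNmul : ∀ x y : ℚ, N (x * y) = N x * N y)
    (hNadd : ∃ C : ℝ, C ≥ 1 ∧ ∀ x y : ℚ, N (x + y) ≤ C * (N x + N y))
    (hNonArch : ∀ x : ℤ, N (x : ℚ) ≤ 1) :
    ∀ x y : ℚ, N (x + y) ≤ max (N x) (N y) := by
  obtain ⟨C, hC, hadd⟩ := hNadd
  have hnn : ∀ x, 0 ≤ N x := fun x => by
    by_cases h : x = 0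
    · rw [h, hN0]
    · exact (hNpos x h).le
  have h1 : N 1 = 1 := by
    have h := hNmul 1 1
    have hp := hNpos 1 one_ne_zero
    rw [mul_one] at h
    nlinarith
  have hpow : ∀ (x : ℚ) (n : ℕ), N (x ^ n) = N x ^ n := fun x n => by
    induction n with
    | zero => simpa using h1
    | succ k ih => rw [pow_succ, pow_succ, hNmul, ih]
  -- coprime integers: one of them has value at least one
  have hcop : ∀ a b : ℤ, IsCoprime a b → 1 ≤ max (N a) (N b) := by
    intro a b hab
    by_contra! hlt
    have hm0 : 0 ≤ max (N a) (N b) := le_max_of_le_left (hnn _)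
    have hCp : (0 : ℝ) < 1 / (2 * C) := by positivity
    obtain ⟨n, hn⟩ := exists_pow_lt_of_lt_one hCp hlt
    obtain ⟨u, v, huv⟩ := (hab.pow (m := n) (n := n))
    have e : (u : ℚ) * (a : ℚ) ^ n + v * (b : ℚ) ^ n = 1 := by exact_mod_cast huv
    have h := hadd ((u : ℚ) * (a : ℚ) ^ n) (v * (b : ℚ) ^ n)
    rw [e, h1, hNmul, hNmul, hpow, hpow] at h
    have ha : N u * N a ^ n ≤ 1 * max (N a) (N b) ^ n :=
      mul_le_mul (hNonArch u) (pow_le_pow_left₀ (hnn _) (le_max_left _ _) n)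
        (pow_nonneg (hnn _) n) zero_le_one
    have hb : N v * N b ^ n ≤ 1 * max (N a) (N b) ^ n :=
      mul_le_mul (hNonArch v) (pow_le_pow_left₀ (hnn _) (le_max_right _ _) n)
        (pow_nonneg (hnn _) n) zero_le_one
    rw [lt_div_iff₀ (by positivity)] at hn
    nlinarith
  have hint : ∀ a b : ℤ, N ((a : ℚ) + b) ≤ max (N a) (N b) := by
    intro a b
    by_cases hg : Int.gcd a b = 0
    · rw [Int.gcd_eq_zero_iff] at hg
      simp [hg.1, hg.2, hN0]
    · obtain ⟨a1, b1, hab, ha, hb⟩ := Int.exists_gcd_one (Nat.pos_of_ne_zero hg)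
      generalize Int.gcd a b = g at *
      have h := hcop a1 b1 (Int.isCoprime_iff_gcd_eq_one.mpr hab)
      have h2 := hNonArch (a1 + b1)
      subst ha hb
      push_cast at h2 ⊢
      rw [← add_mul, hNmul, hNmul, hNmul, ← max_mul_of_nonneg _ _ (hnn _)]
      exact mul_le_mul_of_nonneg_right (h2.trans h) (hnn _)
  intro x y
  have hx : x * (x.den * y.den) = ((x.num * y.den : ℤ) : ℚ) := by
    push_cast
    rw [← mul_assoc, Rat.mul_den_eq_num]
  have hy : y * (x.den * y.den) = ((y.num * x.den : ℤ) : ℚ) := by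
    push_cast
    rw [mul_comm (x.den : ℚ), ← mul_assoc, Rat.mul_den_eq_num]
  have hd : 0 < N (x.den * y.den) := hNpos _ (by simp)
  have h := hint (x.num * y.den) (y.num * x.den)
  rw [← hx, ← hy, ← add_mul, hNmul (x + y), hNmul x, hNmul y, ← max_mul_of_nonneg _ _ hd.le] at h
  exact le_of_mul_le_mul_right h hd
end

section
/- Let p and q be prime numbers with q ≠ p, and suppose that q does not divide p − 1. Then for every a ∈ ℚ_p with |a|_p = 1 there exists x ∈ ℚ_p such that x^q = a. -/
theorem stmt_15 (p q : ℕ) [Fact p.Prime] (hq : q.Prime) (hqp : q ≠ p)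
    (hdvd : ¬ q ∣ (p - 1)) (a : ℚ_[p]) (ha : ‖a‖ = 1) :
    ∃ x : ℚ_[p], x ^ q = a := by
  have hp : p.Prime := Fact.out
  have key : ∀ z : ℤ_[p], ‖z‖ < 1 ↔ PadicInt.toZMod z = 0 := by
    intro z
    rw [← RingHom.mem_ker, PadicInt.ker_toZMod, IsLocalRing.mem_maximalIdeal,
      PadicInt.mem_nonunits]
  let b : ℤ_[p] := ⟨a, ha.le⟩
  have hb : ‖b‖ = 1 := ha
  have hb0 : PadicInt.toZMod b ≠ 0 := by
    rw [Ne, ← key, hb]; exact lt_irrefl _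
  have hcop : (Nat.card (ZMod p)ˣ).Coprime q := by
    rw [Nat.card_eq_fintype_card, ZMod.card_units]
    exact ((Nat.Prime.coprime_iff_not_dvd hq).2 hdvd).symm
  obtain ⟨v, hv⟩ := (powCoprime hcop).surjective (Units.mk0 _ hb0)
  have hv' : (v : ZMod p) ^ q = PadicInt.toZMod b := by
    have := congrArg Units.val hv
    simpa using this
  obtain ⟨y, hy⟩ := ZMod.ringHom_surjective (PadicInt.toZMod (p := p)) (v : ZMod p)
  have hq0 : (q : ZMod p) ≠ 0 := by
    rw [Ne, ZMod.natCast_eq_zero_iff]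
    intro h
    exact hqp ((Nat.prime_dvd_prime_iff_eq hp hq).1 h).symm
  have hd : ‖(q : ℤ_[p]) * y ^ (q - 1)‖ = 1 := by
    refine le_antisymm (PadicInt.norm_le_one _) (not_lt.1 ?_)
    rw [key, map_mul, map_pow, hy, map_natCast]
    exact mul_ne_zero hq0 (pow_ne_zero _ v.ne_zero)
  have hn : ‖y ^ q - b‖ < 1 := by
    rw [key, map_sub, map_pow, hy, hv', sub_self]
  obtain ⟨z, hz, -⟩ := hensels_lemma (F := (Polynomial.X ^ q - Polynomial.C b : Polynomial ℤ_[p]))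
    (a := y) (by simpa [hd, Polynomial.derivative_X_pow] using hn)
  have hz' : z ^ q = b := by
    simpa [sub_eq_zero] using hz
  exact ⟨z, by exact_mod_cast congrArg (fun t : ℤ_[p] => (t : ℚ_[p])) hz'⟩
end
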